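/- Let W be a compact subset of a finite-dimensional normed space Y. Then 2 τ_n(W,Y) ≥ b_n(W,Y), where τ_n(W,Y) is the continuous nonlinear n-width defined via continuous n-term approximation algorithms and b_n(W,Y) is the Bernstein n-width. -/

import Mathlib

open ENNReal Pointwise

/-- `Σ_n(Φ)`: linear combinations of at most `n` elements of the family `Φ`. -/
def SigmaN {Y : Type*} [AddCommGroup Y] [Module ℝ Y] (n : ℕ) (Φ : Set Y) : Set Y :=
  {y | ∃ (c : Fin n → ℝ) (φ : Fin n → Y), (∀ j, φ j ∈ Φ) ∧ y = ∑ j, c j • φ j}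

/-- The continuous nonlinear `n`-width `τ_n(W, Y)`: the infimum over bounded families
`Φ ⊆ Y` meeting every finite-dimensional subspace in a finite set, and over continuous
maps `S : Y → Y` with range in `Σ_n(Φ)`, of the worst-case error `sup_{f ∈ W} ‖f - S f‖`. -/
noncomputable def tauWidth {Y : Type*} [NormedAddCommGroup Y] [NormedSpace ℝ Y]
    (n : ℕ) (W : Set Y) : ℝ :=
  sInf {e : ℝ | ∃ Φ : Set Y, Bornology.IsBounded Φ ∧
    (∀ L : Subspace ℝ Y, FiniteDimensional ℝ L → (Φ ∩ (L : Set Y)).Finite) ∧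
    ∃ S : Y → Y, Continuous S ∧ Set.range S ⊆ SigmaN n Φ ∧ ∀ f ∈ W, ‖f - S f‖ ≤ e}

/-- The Bernstein `n`-width `b_n(W, Y)`. -/
noncomputable def bernsteinWidth {Y : Type*} [NormedAddCommGroup Y] [NormedSpace ℝ Y]
    (n : ℕ) (W : Set Y) : ℝ :=
  sSup {t : ℝ | 0 < t ∧ ∃ L : Subspace ℝ Y, Module.finrank ℝ L = n + 1 ∧
    (t • Metric.closedBall (0 : Y) 1 : Set Y) ∩ (L : Set Y) ⊆ W}

theorem det_poly {E : Type*} [NormedAddCommGroup E] [NormedSpace ℝ E] [FiniteDimensional ℝ E]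
    (A : E →L[ℝ] E) : ∃ p : Polynomial ℝ, p.natDegree ≤ Module.finrank ℝ E ∧
      ∀ τ : ℝ, p.eval τ = (ContinuousLinearMap.id ℝ E + τ • A).det := by
  classical
  let b := Module.finBasis ℝ E
  let M := LinearMap.toMatrix b b (A : E →ₗ[ℝ] E)
  refine ⟨Matrix.det ((Polynomial.X : Polynomial ℝ) • M.map Polynomial.C
    + (1 : Matrix _ _ ℝ).map Polynomial.C), ?_, ?_⟩
  · simpa using Polynomial.natDegree_det_X_add_C_le M 1
  · intro τ
    have h1 : (ContinuousLinearMap.id ℝ E + τ • A).det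
        = (1 + τ • M).det := by
      rw [ContinuousLinearMap.det, ← LinearMap.det_toMatrix b]
      congr 1
      simp [M]
    rw [h1, ← Polynomial.coe_evalRingHom, RingHom.map_det]
    congr 1
    ext i j
    by_cases h : i = j <;> simp [h]
    all_goals ring

/-- Lagrange interpolation with nodes in `(0, δ)`. -/
theorem lagrange_weights (d : ℕ) (δ : ℝ) (hδ : 0 < δ) :
    ∃ (τ w : ℕ → ℝ), (∀ i ∈ Finset.range (d+1), 0 < τ i ∧ τ i ≤ δ) ∧
      ∀ p : Polynomial ℝ, p.natDegree ≤ d →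
        p.eval 1 = ∑ i ∈ Finset.range (d+1), w i * p.eval (τ i) := by
  let τ : ℕ → ℝ := fun i => δ / (i + 1)
  refine ⟨τ, fun i => (Lagrange.basis (Finset.range (d+1)) τ i).eval 1, ?_, ?_⟩
  · intro i _
    refine ⟨by positivity, div_le_self hδ.le (by linarith [Nat.cast_nonneg (α := ℝ) i])⟩
  · intro p hp
    have hinj : Set.InjOn τ (Finset.range (d+1) : Finset ℕ) := by
      intro i _ j _ hij
      have : (i:ℝ) = j := by
        simp only [τ] at hij
        field_simp at hij
        linarith
      exact_mod_cast this
    have h := Lagrange.eq_interpolate (f := p) hinj (by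
      rw [Finset.card_range]
      exact lt_of_le_of_lt Polynomial.degree_le_natDegree (by exact_mod_cast Nat.lt_succ_of_le hp))
    conv_lhs => rw [h, Lagrange.interpolate_apply, Polynomial.eval_finsetSum]
    simp [mul_comm]

theorem det_pos {E : Type*} [NormedAddCommGroup E] [NormedSpace ℝ E] [FiniteDimensional ℝ E]
    (A : E →L[ℝ] E) (τ C : ℝ) (h0 : 0 ≤ τ) (hA : ‖A‖ ≤ C) (h1 : τ * C < 1) :
    0 < (ContinuousLinearMap.id ℝ E + τ • A).det := by
  obtain ⟨p, -, hp⟩ := det_poly A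
  rw [← hp]
  by_contra hneg
  push Not at hneg
  have hz : (0:ℝ) ∈ (fun σ => p.eval σ) '' Set.Icc 0 τ := by
    apply intermediate_value_Icc' h0 p.continuous.continuousOn
    refine ⟨hneg, ?_⟩
    rw [hp]
    simp [ContinuousLinearMap.det]
  obtain ⟨σ, ⟨hσ0, hστ⟩, hσ⟩ := hz
  simp only [hp] at hσ
  have hker := LinearMap.bot_lt_ker_of_det_eq_zero hσ
  obtain ⟨v, hv, hv0⟩ := Submodule.exists_mem_ne_zero_of_ne_bot hker.ne'
  have hv' : v + σ • A v = 0 := by simpa using hv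
  have hn : ‖v‖ = σ * ‖A v‖ := by
    rw [eq_neg_of_add_eq_zero_left hv', norm_neg, norm_smul, Real.norm_of_nonneg hσ0, ← neg_eq_iff_add_eq_zero.mpr hv' ]
    simp
  have hAv : ‖A v‖ ≤ C * ‖v‖ := A.le_of_opNorm_le hA v
  have hvpos : 0 < ‖v‖ := norm_pos_iff.mpr hv0
  have hC : 0 ≤ C := (norm_nonneg _).trans hA
  have : σ * ‖A v‖ ≤ τ * (C * ‖v‖) := mul_le_mul hστ hAv (norm_nonneg _) h0
  nlinarith

open MeasureTheory Measure in
theorem vol_eq {E : Type*} [NormedAddCommGroup E] [NormedSpace ℝ E] [FiniteDimensional ℝ E]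
    [MeasurableSpace E] [BorelSpace E]
    (u : E → E) (C : NNReal) (hu : LipschitzWith C u) (t : ℝ)
    (hut : ∀ x, t ≤ ‖x‖ → u x = 0) (τ : ℝ) (h0 : 0 ≤ τ) (h1 : τ * C < 1) :
    IntegrableOn (fun x => (ContinuousLinearMap.id ℝ E + τ • fderiv ℝ u x).det)
      (Metric.ball (0:E) t) μH[Module.finrank ℝ E] ∧
    ∫ x in Metric.ball (0:E) t, (ContinuousLinearMap.id ℝ E + τ • fderiv ℝ u x).det
      ∂μH[Module.finrank ℝ E] = (μH[Module.finrank ℝ E]).real (Metric.ball (0:E) t) := by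
  set μ : Measure E := μH[Module.finrank ℝ E] with hμ
  have : IsAddHaarMeasure μ := isAddHaarMeasure_hausdorffMeasure
  let f : E → E := fun x => x + τ • u x
  have hlip : ∀ x y, ‖τ • u x - τ • u y‖ ≤ (τ * C) * ‖x - y‖ := by
    intro x y
    rw [← smul_sub, norm_smul, Real.norm_of_nonneg h0, mul_assoc]
    exact mul_le_mul_of_nonneg_left (hu.norm_sub_le x y) h0
  have hinj : Function.Injective f := by
    intro x y hxy
    have h2 : x - y = -(τ • u x - τ • u y) := by
      have : x + τ • u x = y + τ • u y := hxy
      rw [neg_sub, sub_eq_sub_iff_add_eq_add, this, add_comm]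
    have h3 := hlip x y
    rw [← norm_neg, ← h2] at h3
    by_contra hne
    have : 0 < ‖x - y‖ := norm_pos_iff.mpr (sub_ne_zero.mpr hne)
    nlinarith
  let c : NNReal := ⟨τ * C, by positivity⟩
  have hsurj : Function.Surjective f := by
    have happ : ApproximatesLinearOn f ((ContinuousLinearEquiv.refl ℝ E : E ≃L[ℝ] E) : E →L[ℝ] E)
        Set.univ c := by
      intro x _ y _
      have : f x - f y - ((ContinuousLinearEquiv.refl ℝ E : E ≃L[ℝ] E) : E →L[ℝ] E) (x - y)
          = τ • u x - τ • u y := by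
        simp [f]; abel
      rw [this]
      exact hlip x y
    apply happ.surjective
    rcases subsingleton_or_nontrivial E with h | h
    · exact Or.inl h
    · right
      have : ‖(((ContinuousLinearEquiv.refl ℝ E).symm : E ≃L[ℝ] E) : E →L[ℝ] E)‖₊ = 1 := by
        ext
        simp
      rw [this, inv_one]
      exact_mod_cast h1
  have hfout : ∀ x, t ≤ ‖x‖ → f x = x := by
    intro x hx
    simp [f, hut x hx]
  have himg : f '' Metric.ball 0 t = Metric.ball 0 t := by
    ext y
    simp only [Set.mem_image, mem_ball_zero_iff]
    constructor
    · rintro ⟨x, hx, rfl⟩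
      by_contra hy
      push Not at hy
      have := hinj (hfout _ hy)
      rw [this] at hy
      linarith
    · intro hy
      obtain ⟨x, rfl⟩ := hsurj y
      refine ⟨x, ?_, rfl⟩
      by_contra hx
      push Not at hx
      rw [hfout x hx] at hy
      linarith
  have hflip : LipschitzWith (1 + c) f := by
    apply LipschitzWith.add LipschitzWith.id
    apply LipschitzWith.of_dist_le_mul
    intro x y
    rw [dist_eq_norm, dist_eq_norm]
    exact hlip x y
  have hae : ∀ᵐ x ∂μ, DifferentiableAt ℝ u x := hu.ae_differentiableAt
  let N : Set E := {x | DifferentiableAt ℝ u x}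
  have hN : MeasurableSet N := measurableSet_of_differentiableAt ℝ u
  have hNc : μ Nᶜ = 0 := hae
  have hnull : μ (f '' Nᶜ) = 0 := by
    have := hflip.hausdorffMeasure_image_le (d := Module.finrank ℝ E) (by positivity) Nᶜ
    rw [← hμ, hNc, mul_zero] at this
    exact le_antisymm this bot_le
  let D := Metric.ball (0:E) t ∩ N
  have hD : MeasurableSet D := Metric.isOpen_ball.measurableSet.inter hN
  have hchg := lintegral_abs_det_fderiv_eq_addHaar_image μ hD (f := f)
    (f' := fun x => ContinuousLinearMap.id ℝ E + τ • fderiv ℝ u x)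
    (fun x hx => by
      have hx2 : DifferentiableAt ℝ u x := hx.2
      exact ((hasFDerivAt_id x).add (hx2.hasFDerivAt.const_smul τ)).hasFDerivWithinAt) hinj.injOn
  have hDimg : μ (f '' D) = μ (Metric.ball 0 t) := by
    apply le_antisymm
    · rw [← himg]
      exact measure_mono (Set.image_mono Set.inter_subset_left)
    · calc μ (Metric.ball 0 t) = μ (f '' Metric.ball 0 t) := by rw [himg]
        _ ≤ μ (f '' D ∪ f '' Nᶜ) := by
            apply measure_mono
            rw [← Set.image_union]
            apply Set.image_mono
            intro x hx
            by_cases hxN : x ∈ N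
            · exact Or.inl ⟨hx, hxN⟩
            · exact Or.inr hxN
        _ ≤ μ (f '' D) + μ (f '' Nᶜ) := measure_union_le _ _
        _ = μ (f '' D) := by rw [hnull, add_zero]
  have hDae : (Metric.ball (0:E) t : Set E) =ᵐ[μ] D := by
    filter_upwards [hae] with x hx
    apply propext
    exact ⟨fun h => ⟨h, hx⟩, fun h => h.1⟩
  have hpos : ∀ x, 0 < (ContinuousLinearMap.id ℝ E + τ • fderiv ℝ u x).det := fun x =>
    det_pos _ τ C h0 (norm_fderiv_le_of_lipschitz ℝ hu) h1
  simp only [abs_of_pos (hpos _)] at hchg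
  rw [hDimg, ← setLIntegral_congr hDae] at hchg
  have hmeas : Measurable (fun x => (ContinuousLinearMap.id ℝ E + τ • fderiv ℝ u x).det) :=
    ContinuousLinearMap.continuous_det.measurable.comp
      ((measurable_fderiv ℝ u).const_smul τ |>.const_add _)
  have hfin : μ (Metric.ball (0:E) t) < ⊤ := measure_ball_lt_top
  constructor
  · refine ⟨hmeas.aestronglyMeasurable, ?_⟩
    rw [hasFiniteIntegral_iff_ofReal (Filter.Eventually.of_forall fun x => (hpos x).le), hchg]
    exact hfin
  · rw [integral_eq_lintegral_of_nonneg_ae (Filter.Eventually.of_forall fun x => (hpos x).le)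
      hmeas.aestronglyMeasurable, hchg]
    rfl

open MeasureTheory Measure in
theorem no_retraction {E : Type*} [NormedAddCommGroup E] [NormedSpace ℝ E] [FiniteDimensional ℝ E]
    (u : E → E) (C : NNReal) (hu : LipschitzWith C u) (t : ℝ) (ht : 0 < t)
    (hut : ∀ x, t ≤ ‖x‖ → u x = 0) (hin : ∀ x, ‖x‖ < t → ‖x + u x‖ = t) : False := by
  borelize E
  have hvol := vol_eq u C hu t hut
  set μ : Measure E := μH[Module.finrank ℝ E] with hμ
  have : IsAddHaarMeasure μ := isAddHaarMeasure_hausdorffMeasure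
  obtain ⟨τ, w, hτ, hw⟩ := lagrange_weights (Module.finrank ℝ E) (1 / (C + 1)) (by positivity)
  have hτ' : ∀ i ∈ Finset.range (Module.finrank ℝ E + 1), 0 ≤ τ i ∧ τ i * C < 1 := by
    intro i hi
    obtain ⟨h1, h2⟩ := hτ i hi
    refine ⟨h1.le, ?_⟩
    rw [le_div_iff₀ (by positivity)] at h2
    nlinarith [C.coe_nonneg]
  have hsum : ∀ A : E →L[ℝ] E, (ContinuousLinearMap.id ℝ E + A).det
      = ∑ i ∈ Finset.range (Module.finrank ℝ E + 1),
        w i * (ContinuousLinearMap.id ℝ E + τ i • A).det := by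
    intro A
    obtain ⟨p, hp, hpe⟩ := det_poly A
    have := hw p hp
    simp only [hpe, one_smul] at this
    exact this
  have hw1 : ∑ i ∈ Finset.range (Module.finrank ℝ E + 1), w i = 1 := by
    have := hw 1 (by simp)
    simp at this
    exact this.symm
  have hint : ∫ x in Metric.ball (0:E) t, (ContinuousLinearMap.id ℝ E + fderiv ℝ u x).det ∂μ
      = μ.real (Metric.ball (0:E) t) := by
    rw [integral_congr_ae (Filter.Eventually.of_forall fun x => hsum (fderiv ℝ u x))]
    rw [integral_finsetSum _ (fun i hi =>
      ((hvol (τ i) (hτ' i hi).1 (hτ' i hi).2).1.const_mul (w i)))]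
    rw [Finset.sum_congr rfl (fun i hi => by
      rw [integral_const_mul, (hvol (τ i) (hτ' i hi).1 (hτ' i hi).2).2])]
    rw [← Finset.sum_mul, hw1, one_mul]
  have hzero : ∫ x in Metric.ball (0:E) t, (ContinuousLinearMap.id ℝ E + fderiv ℝ u x).det ∂μ
      = 0 := by
    apply integral_eq_zero_of_ae
    have hae : ∀ᵐ x ∂μ, DifferentiableAt ℝ u x := hu.ae_differentiableAt
    rw [Filter.EventuallyEq, ae_restrict_iff' Metric.isOpen_ball.measurableSet]
    filter_upwards [hae] with x hx hxt
    by_contra hdet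
    simp only [Pi.zero_apply] at hdet
    set A := ContinuousLinearMap.id ℝ E + fderiv ℝ u x with hA
    have hG : HasFDerivAt (fun y => y + u y) A x := (hasFDerivAt_id x).add hx.hasFDerivAt
    have hunit : IsUnit (A : E →ₗ[ℝ] E) := by
      rw [LinearMap.isUnit_iff_isUnit_det]
      exact isUnit_iff_ne_zero.mpr hdet
    have hAs : Function.Surjective (A : E →ₗ[ℝ] E) :=
      ((Module.End.isUnit_iff _).mp hunit).2
    obtain ⟨v, hv⟩ := hAs (x + u x)
    have hv' : A v = x + u x := hv
    have hline : HasDerivAt (fun ε : ℝ => x + ε • v) v 0 := by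
      simpa using ((hasDerivAt_id (0:ℝ)).smul_const v).const_add x
    have hcurve : HasDerivAt (fun ε : ℝ => (x + ε • v) + u (x + ε • v)) (x + u x) 0 := by
      rw [← hv']
      have hG' : HasFDerivAt (fun y => y + u y) A (x + (0:ℝ) • v) := by simpa using hG
      exact hG'.comp_hasDerivAt (0:ℝ) hline
    have hlit := hcurve.isLittleO
    have hev := hlit.def (c := t / 2) (by positivity)
    have hnear : ∀ᶠ ε : ℝ in nhds 0, ‖x + ε • v‖ < t := by
      have hc : Continuous (fun ε : ℝ => ‖x + ε • v‖) := by fun_prop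
      apply hc.continuousAt.eventually_lt_const
      simpa using hxt
    obtain ⟨η, hη, hηb⟩ := Metric.eventually_nhds_iff.mp (hev.and hnear)
    obtain ⟨h1, h2⟩ := hηb (y := η / 2) (by
      rw [Real.dist_eq, sub_zero, abs_of_pos (by positivity)]; linarith)
    have hxt' : ‖x‖ < t := by simpa using hxt
    have h3 := hin _ h2
    have h4 := hin x hxt'
    simp only [zero_smul, add_zero, sub_zero] at h1
    rw [Real.norm_of_nonneg (by positivity : (0:ℝ) ≤ η / 2)] at h1
    have h5 : ‖(1 + η / 2) • (x + u x)‖ = (1 + η / 2) * t := by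
      rw [norm_smul, h4, Real.norm_of_nonneg (by positivity)]
    have h6 : (1 + η / 2) • (x + u x) = (x + (η / 2) • v + u (x + (η / 2) • v))
      - (x + (η / 2) • v + u (x + (η / 2) • v) - (x + u x) - (η / 2) • (x + u x)) := by
      module
    have h7 := norm_sub_le (x + (η / 2) • v + u (x + (η / 2) • v))
      (x + (η / 2) • v + u (x + (η / 2) • v) - (x + u x) - (η / 2) • (x + u x))
    rw [← h6, h5, h3] at h7
    nlinarith
  have hposm : 0 < μ.real (Metric.ball (0:E) t) :=
    ENNReal.toReal_pos (Metric.measure_ball_pos μ 0 ht).ne' measure_ball_lt_top.ne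
  linarith

theorem locLip_comp {α E F : Type*} [PseudoMetricSpace α] [NormedAddCommGroup E] [NormedSpace ℝ E]
    [NormedAddCommGroup F] [NormedSpace ℝ F] {f : α → E} {φ : E → F} (hf : LocallyLipschitz f)
    (hφ : ∀ x, ContDiffAt ℝ 1 φ (f x)) : LocallyLipschitz (fun x => φ (f x)) := by
  intro x
  obtain ⟨K, s, hs, hK⟩ := (hφ x).exists_lipschitzOnWith
  obtain ⟨K', s', hs', hK'⟩ := hf x
  refine ⟨K * K', s' ∩ f ⁻¹' s, Filter.inter_mem hs' (hf.continuous.continuousAt hs), ?_⟩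
  exact hK.comp (hK'.mono Set.inter_subset_left) (fun y hy => hy.2)

theorem lip_of_locLip {E : Type*} [NormedAddCommGroup E] [NormedSpace ℝ E] [FiniteDimensional ℝ E]
    (u : E → E) (hu : LocallyLipschitz u) (t : ℝ) (hut : ∀ x, t ≤ ‖x‖ → u x = 0) :
    ∃ C : NNReal, LipschitzWith C u := by
  have hcomp : IsCompact (Metric.closedBall (0:E) (t+1)) := isCompact_closedBall _ _
  obtain ⟨K, hK⟩ := LocallyLipschitzOn.exists_lipschitzOnWith_of_compact hcomp
    hu.locallyLipschitzOn
  obtain ⟨M, hM⟩ := hcomp.exists_bound_of_continuousOn hu.continuous.continuousOn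
  have hM' : ∀ x, ‖u x‖ ≤ max M 0 := by
    intro x
    by_cases hx : t ≤ ‖x‖
    · rw [hut x hx, norm_zero]; exact le_max_right _ _
    · exact (hM x (by rw [mem_closedBall_zero_iff]; linarith)).trans (le_max_left _ _)
  refine ⟨K + ⟨2 * max M 0, by positivity⟩, LipschitzWith.of_dist_le_mul fun x y => ?_⟩
  have h0 : 0 ≤ max M 0 := le_max_right _ _
  change dist (u x) (u y) ≤ (K + 2 * max M 0) * dist x y
  have hd : 0 ≤ dist x y := dist_nonneg
  by_cases hxy : 1 ≤ dist x y
  · have : dist (u x) (u y) ≤ 2 * max M 0 := by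
      rw [dist_eq_norm]
      linarith [norm_sub_le (u x) (u y), hM' x, hM' y]
    nlinarith [K.coe_nonneg]
  · push Not at hxy
    by_cases hx : ‖x‖ ≤ t + 1 ∧ ‖y‖ ≤ t + 1
    · have := hK.dist_le_mul x (by simpa using hx.1) y (by simpa using hx.2)
      nlinarith
    · have hn1 : ‖x‖ ≤ ‖y‖ + dist x y := by
        rw [dist_eq_norm]; linarith [norm_sub_norm_le x y]
      have hn2 : ‖y‖ ≤ ‖x‖ + dist x y := by
        rw [dist_comm, dist_eq_norm]; linarith [norm_sub_norm_le y x]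
      have hx1 : t ≤ ‖x‖ := by
        by_contra h
        push Not at h
        exact hx ⟨by linarith, by linarith⟩
      have hy1 : t ≤ ‖y‖ := by
        by_contra h
        push Not at h
        exact hx ⟨by linarith, by linarith⟩
      rw [hut x hx1, hut y hy1, dist_self]
      have := K.coe_nonneg
      positivity

/-- A locally Lipschitz map close to the identity on a ball has a zero. -/
theorem exists_zero_locLip {E : Type*} [NormedAddCommGroup E] [NormedSpace ℝ E]
    [FiniteDimensional ℝ E] (h : E → E) (hh : LocallyLipschitz h) (s t : ℝ) (hs : 0 ≤ s)
    (hst : s < t) (hclose : ∀ x, ‖x‖ ≤ t → ‖h x - x‖ ≤ s) : ∃ x, ‖x‖ ≤ t ∧ h x = 0 := by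
  by_contra hno
  push Not at hno
  have ht : 0 < t := hs.trans_lt hst
  have hnorm : LocallyLipschitz (fun x : E => ‖x‖) := lipschitzWith_one_norm.locallyLipschitz
  let χ : E → ℝ := fun x => max 0 (min 1 ((t - ‖x‖) / (t - s)))
  have hχ : LocallyLipschitz χ := by
    apply LocallyLipschitz.const_max
    apply LocallyLipschitz.const_min
    exact locLip_comp (φ := fun r : ℝ => (t - r) / (t - s)) hnorm (fun x => by fun_prop)
  have hχ0 : ∀ x, 0 ≤ χ x := fun x => le_max_left _ _
  have hχ1 : ∀ x, χ x ≤ 1 := fun x => max_le zero_le_one (min_le_left _ _)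
  have hχs : ∀ x, ‖x‖ ≤ s → χ x = 1 := by
    intro x hx
    have : 1 ≤ (t - ‖x‖) / (t - s) := by
      rw [le_div_iff₀ (by linarith)]; linarith
    simp [χ, min_eq_left this]
  have hχt : ∀ x, t ≤ ‖x‖ → χ x = 0 := by
    intro x hx
    have : (t - ‖x‖) / (t - s) ≤ 0 := div_nonpos_of_nonpos_of_nonneg (by linarith) (by linarith)
    exact max_eq_left ((min_le_right _ _).trans this)
  let F : E → E := fun x => x + χ x • (h x - x)
  have hF : LocallyLipschitz F :=
    locLip_comp (φ := fun q : ℝ × E × E => q.2.1 + q.1 • (q.2.2 - q.2.1))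
      (hχ.prodMk (LocallyLipschitz.id.prodMk hh)) (fun x => by fun_prop)
  have hFt : ∀ x, t ≤ ‖x‖ → F x = x := by
    intro x hx
    simp [F, hχt x hx]
  have hF0 : ∀ x, F x ≠ 0 := by
    intro x hx
    by_cases hxt : t ≤ ‖x‖
    · rw [hFt x hxt] at hx
      rw [hx, norm_zero] at hxt
      linarith
    push Not at hxt
    by_cases hxs : ‖x‖ ≤ s
    · apply hno x hxt.le
      simpa [F, hχs x hxs] using hx
    · push Not at hxs
      have h1 : x = -(χ x • (h x - x)) := eq_neg_of_add_eq_zero_left hx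
      have h2 : ‖x‖ = χ x * ‖h x - x‖ := by
        conv_lhs => rw [h1]
        rw [norm_neg, norm_smul, Real.norm_of_nonneg (hχ0 x)]
      have h3 := hclose x hxt.le
      have h4 : χ x * ‖h x - x‖ ≤ 1 * s := mul_le_mul (hχ1 x) h3 (norm_nonneg _) zero_le_one
      linarith
  let u : E → E := fun x => (max t ‖x‖ * ‖F x‖⁻¹) • F x - x
  have hnF : LocallyLipschitz (fun x => ‖F x‖) := hnorm.comp hF
  have hu : LocallyLipschitz u := by
    apply locLip_comp (φ := fun q : ℝ × ℝ × E × E => (q.1 * q.2.1⁻¹) • q.2.2.1 - q.2.2.2)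
      ((hnorm.const_max t).prodMk (hnF.prodMk (hF.prodMk LocallyLipschitz.id)))
    intro x
    have : ‖F x‖ ≠ 0 := norm_ne_zero_iff.mpr (hF0 x)
    have h1 : ContDiffAt ℝ 1 (fun q : ℝ × ℝ × E × E => q.2.1⁻¹)
        (max t ‖x‖, ‖F x‖, F x, id x) := ContDiffAt.inv (by fun_prop) this
    exact ((contDiffAt_fst.mul h1).smul (by fun_prop)).sub (by fun_prop)
  have hut : ∀ x, t ≤ ‖x‖ → u x = 0 := by
    intro x hx
    have hx0 : ‖x‖ ≠ 0 := by linarith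
    simp [u, hFt x hx, max_eq_right hx, hx0]
  obtain ⟨C, hC⟩ := lip_of_locLip u hu t hut
  apply no_retraction u C hC t ht hut
  intro x hx
  have : ‖F x‖ ≠ 0 := norm_ne_zero_iff.mpr (hF0 x)
  have h1 : x + u x = (max t ‖x‖ * ‖F x‖⁻¹) • F x := by simp [u]
  rw [h1, norm_smul, max_eq_left hx.le, norm_mul, norm_inv, norm_norm, mul_assoc,
    inv_mul_cancel₀ this, mul_one, Real.norm_of_nonneg ht.le]

theorem exists_preimage {E : Type*} [NormedAddCommGroup E] [NormedSpace ℝ E]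
    [FiniteDimensional ℝ E] (h : E → E) (hh : Continuous h) (s t : ℝ) (hs : 0 ≤ s)
    (hclose : ∀ x, ‖x‖ ≤ t → ‖h x - x‖ ≤ s) (y : E) (hy : ‖y‖ < t - s) :
    ∃ x, ‖x‖ ≤ t ∧ h x = y := by
  by_contra hno
  push Not at hno
  have ht : 0 ≤ t := by linarith [norm_nonneg y]
  have hcomp : IsCompact (Metric.closedBall (0:E) t) := isCompact_closedBall _ _
  obtain ⟨x0, hx0, hmin⟩ := hcomp.exists_isMinOn ⟨0, by simpa using ht⟩
    (f := fun x => ‖h x - y‖) (by fun_prop)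
  have hη : 0 < ‖h x0 - y‖ :=
    norm_pos_iff.mpr (sub_ne_zero.mpr (hno x0 (by simpa using hx0)))
  set η := ‖h x0 - y‖
  let ε := min η ((t - s - ‖y‖) / 2)
  have hε : 0 < ε := lt_min hη (by linarith)
  have hε2 : ε ≤ (t - s - ‖y‖) / 2 := min_le_right _ _
  obtain ⟨g, hg, hgε, -⟩ := Continuous.exists_contDiff_approx (f := fun x => h x - y)
    (ε := fun _ => ε) 1 (by fun_prop) (by fun_prop) (fun _ => hε)
  obtain ⟨x, hx, hgx⟩ := exists_zero_locLip g (ContDiff.locallyLipschitz (𝕂 := ℝ) (by exact_mod_cast hg))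
    (ε + ‖y‖ + s) t (by positivity) (by linarith) (by
      intro x hx
      have h1 := (hgε x).le
      rw [dist_eq_norm] at h1
      have h2 : g x - x = (g x - (h x - y)) + (-y) + (h x - x) := by abel
      rw [h2]
      refine (norm_add₃_le).trans ?_
      rw [norm_neg]
      linarith [hclose x hx])
  have h1 := hgε x
  rw [hgx, dist_zero_left] at h1
  have h2 : η ≤ ‖h x - y‖ := hmin (by simpa using hx)
  have h3 : ε ≤ η := min_le_left _ _
  linarith

open Manifold in
theorem core {Y : Type*} [NormedAddCommGroup Y] [NormedSpace ℝ Y] [FiniteDimensional ℝ Y]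
    (n : ℕ) (Φ : Set Y) (hΦ : Φ.Finite) (S : Y → Y) (hS : Continuous S)
    (hr : Set.range S ⊆ SigmaN n Φ) (L : Subspace ℝ Y) (hL : Module.finrank ℝ L = n + 1)
    (t e : ℝ) (he : ∀ f : L, ‖f‖ ≤ t → ‖(f:Y) - S f‖ ≤ e) (ht : 0 < t) : t ≤ 2 * e := by
  by_contra hlt
  push Not at hlt
  have he0 : 0 ≤ e := (norm_nonneg _).trans (he 0 (by simpa using ht.le))
  let δ := (t - 2 * e) / 2
  have hδ : 0 < δ := by simp only [δ]; linarith
  let T : Y → Set L := fun y => {z | ∀ f : L, ‖f‖ ≤ t → S f = y → ‖z - f‖ ≤ 2 * e + δ}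
  have hT : ∀ y, Convex ℝ (T y) := by
    intro y
    have : T y = ⋂ (f : L) (_ : ‖f‖ ≤ t) (_ : S f = y), Metric.closedBall f (2 * e + δ) := by
      ext z
      simp [T, dist_eq_norm]
    rw [this]
    exact convex_iInter fun f => convex_iInter fun _ => convex_iInter fun _ =>
      convex_closedBall _ _
  obtain ⟨g, hg⟩ := exists_contMDiffMap_forall_mem_convex_of_local_const (n := 1) 𝓘(ℝ, Y) hT (by
    intro y
    by_cases hex : ∃ f0 : L, ‖f0‖ ≤ t ∧ dist (S f0) y < δ / 2
    · obtain ⟨f0, hf0, hd⟩ := hex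
      refine ⟨f0, ?_⟩
      filter_upwards [Metric.ball_mem_nhds y (half_pos hδ)] with y' hy' f hf hfy
      have h1 := he f hf
      have h2 := he f0 hf0
      have h3 : dist (S f0) (S f) ≤ δ := by
        rw [hfy]
        have := dist_triangle_right (S f0) y' y
        rw [Metric.mem_ball] at hy'
        linarith
      rw [dist_eq_norm] at h3
      have h4 : ((f0 - f : L) : Y) = ((f0:Y) - S f0) + (S f0 - S f) + (-((f:Y) - S f)) := by
        push_cast; abel
      rw [Submodule.coe_norm, h4]
      refine norm_add₃_le.trans ?_
      rw [norm_neg]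
      linarith
    · push Not at hex
      refine ⟨0, ?_⟩
      filter_upwards [Metric.ball_mem_nhds y (half_pos hδ)] with y' hy' f hf hfy
      have := hex f hf
      rw [hfy] at this
      rw [Metric.mem_ball] at hy'
      linarith)
  have hgd : ContDiff ℝ 1 g := g.contMDiff.contDiff
  let h : L → L := fun f => g (S f)
  have hh : Continuous h := hgd.continuous.comp (hS.comp continuous_subtype_val)
  have hpre := exists_preimage h hh (2 * e + δ) t (by positivity)
    (fun x hx => hg (S x) x hx rfl)
  have hsub : Metric.ball (0:L) (t - (2 * e + δ)) ⊆ ⋃ φ : Fin n → Φ,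
      Set.range (fun c : Fin n → ℝ => g (∑ j, c j • (φ j : Y))) := by
    intro y hy
    obtain ⟨x, -, hxy⟩ := hpre y (by simpa using hy)
    obtain ⟨c, φ, hφ, hSx⟩ := hr ⟨(x:Y), rfl⟩
    refine Set.mem_iUnion.mpr ⟨fun j => ⟨φ j, hφ j⟩, c, ?_⟩
    rw [← hxy]
    simp only [h, hSx]
  have : Finite Φ := hΦ
  have hdim := dimH_mono hsub
  rw [Real.dimH_of_mem_nhds (Metric.ball_mem_nhds (0:L) (by simp only [δ]; linarith)), hL,
    dimH_iUnion] at hdim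
  have hle : (⨆ φ : Fin n → Φ, dimH (Set.range (fun c : Fin n → ℝ => g (∑ j, c j • (φ j : Y)))))
      ≤ (n : ENNReal) := by
    refine iSup_le fun φ => ?_
    have hc : ContDiff ℝ 1 (fun c : Fin n → ℝ => g (∑ j, c j • (φ j : Y))) :=
      hgd.comp (by fun_prop)
    simpa using hc.dimH_range_le
  have := hdim.trans hle
  norm_cast at this
  omega

theorem two_tau_ge_bernstein {Y : Type*} [NormedAddCommGroup Y] [NormedSpace ℝ Y]
    [FiniteDimensional ℝ Y] (n : ℕ) (W : Set Y) (hW : IsCompact W) :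
    bernsteinWidth n W ≤ 2 * tauWidth n W := by
  have hτ0 : 0 ≤ tauWidth n W := by
    unfold tauWidth
    rcases W.eq_empty_or_nonempty with rfl | ⟨f, hf⟩
    · have : {e : ℝ | ∃ Φ : Set Y, Bornology.IsBounded Φ ∧
        (∀ L : Subspace ℝ Y, FiniteDimensional ℝ L → (Φ ∩ (L : Set Y)).Finite) ∧
        ∃ S : Y → Y, Continuous S ∧ Set.range S ⊆ SigmaN n Φ ∧
          ∀ f ∈ (∅ : Set Y), ‖f - S f‖ ≤ e} = Set.univ := by
        ext e
        simp only [Set.mem_setOf_eq, Set.mem_univ, iff_true]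
        refine ⟨{0}, Bornology.isBounded_singleton, fun L _ => (Set.finite_singleton _).inter_of_left _,
          fun _ => 0, continuous_const, ?_, by simp⟩
        rintro _ ⟨x, rfl⟩
        exact ⟨0, fun _ => 0, fun _ => rfl, by simp⟩
      rw [this]
      simp
    · apply Real.sInf_nonneg
      rintro e ⟨Φ, -, -, S, -, -, h⟩
      exact (norm_nonneg _).trans (h f hf)
  apply Real.sSup_le _ (by positivity)
  rintro t ⟨ht, L, hL, hLW⟩
  have hne : {e : ℝ | ∃ Φ : Set Y, Bornology.IsBounded Φ ∧
    (∀ L : Subspace ℝ Y, FiniteDimensional ℝ L → (Φ ∩ (L : Set Y)).Finite) ∧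
    ∃ S : Y → Y, Continuous S ∧ Set.range S ⊆ SigmaN n Φ ∧ ∀ f ∈ W, ‖f - S f‖ ≤ e}.Nonempty := by
    obtain ⟨M, hM⟩ := hW.isBounded.exists_norm_le
    refine ⟨M, {0}, Bornology.isBounded_singleton,
      fun L _ => (Set.finite_singleton _).inter_of_left _, fun _ => 0, continuous_const, ?_,
      by simpa using hM⟩
    rintro _ ⟨x, rfl⟩
    exact ⟨0, fun _ => 0, fun _ => rfl, by simp⟩
  have : t / 2 ≤ tauWidth n W := by
    apply le_csInf hne
    rintro e ⟨Φ, -, hfin, S, hS, hr, he⟩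
    have hΦ : Φ.Finite := by
      have := hfin ⊤ inferInstance
      simpa using this
    have := core n Φ hΦ S hS hr L hL t e (fun f hf => he f (hLW ⟨?_, f.2⟩)) ht
    · linarith
    · rw [smul_closedBall _ _ zero_le_one]
      simpa [abs_of_pos ht] using hf
  linarith
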